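/- The number of involutions in the symmetric group S_n equals the number of standard Young tableaux with n boxes. -/

import Mathlib

/-- A standard Young tableau with `n` boxes: a Young diagram with `n` cells together
with a filling of the cells by the numbers `1, …, n`, each used exactly once
(injectivity plus cardinality), strictly increasing along rows and down columns.
The entry is `0` outside the diagram (to make the data canonical). -/
structure StandardYoungTableau (n : ℕ) where
  shape : YoungDiagram
  card_eq : shape.card = n
  entry : ℕ → ℕ → ℕ
  row_strict : ∀ i j1 j2, j1 < j2 → (i, j2) ∈ shape → entry i j1 < entry i j2
  col_strict : ∀ i1 i2 j, i1 < i2 → (i2, j) ∈ shape → entry i1 j < entry i2 j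
  entry_mem : ∀ i j, (i, j) ∈ shape → entry i j ∈ Finset.Icc 1 n
  entry_injOn : Set.InjOn (fun c : ℕ × ℕ => entry c.1 c.2) {c : ℕ × ℕ | c ∈ shape}
  entry_eq_zero : ∀ i j, (i, j) ∉ shape → entry i j = 0

/-- Number of involutions of a type. -/
noncomputable def invCount (α : Type) : ℕ := Nat.card {w : Equiv.Perm α // w * w = 1}

theorem invCount_congr {α β : Type} (e : α ≃ β) : invCount α = invCount β := by
  refine Nat.card_congr (Equiv.subtypeEquiv e.permCongr ?_)
  intro w
  have h := e.permCongrHom.map_mul w w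
  have h' : e.permCongr w * e.permCongr w = e.permCongr (w * w) := h.symm
  rw [h']
  constructor
  · intro h; rw [h]; exact e.permCongrHom.map_one
  · intro h
    apply e.permCongrHom.injective
    rw [map_one]; exact h

theorem invCount_fix {α : Type} (p : α → Prop) [DecidablePred p] :
    Nat.card {w : Equiv.Perm α // w * w = 1 ∧ ∀ a, ¬ p a → w a = a} = invCount (Subtype p) := by
  symm
  refine Nat.card_congr ?_
  refine (Equiv.subtypeEquiv (q := fun f => f.1 * f.1 = 1) (Equiv.Perm.subtypeEquivSubtypePerm p) ?_).trans ?_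
  · intro w
    simp only [Equiv.Perm.subtypeEquivSubtypePerm_apply_coe]
    rw [← map_mul, ← map_one (Equiv.Perm.ofSubtype (p := p))]
    exact (Equiv.Perm.ofSubtype_injective (p := p)).eq_iff.symm
  · refine (Equiv.subtypeSubtypeEquivSubtypeInter _ (fun f : Equiv.Perm α => f * f = 1)).trans ?_
    exact Equiv.subtypeEquivRight (fun _ => and_comm)

theorem invCount_move {α : Type} [DecidableEq α] (x y : α) :
    Nat.card {w : Equiv.Perm α // w * w = 1 ∧ w x = y} =
      invCount {z : α // z ≠ x ∧ z ≠ y} := by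
  rw [← invCount_fix]
  have key : ∀ w : Equiv.Perm α, w * w = 1 → w * Equiv.swap x y = Equiv.swap x y * w →
      (w * Equiv.swap x y) * (w * Equiv.swap x y) = 1 := by
    intro w hw h
    calc _ = w * (Equiv.swap x y * w) * Equiv.swap x y := by simp only [mul_assoc]
      _ = (w * w) * (Equiv.swap x y * Equiv.swap x y) := by rw [← h]; simp only [mul_assoc]
      _ = 1 := by rw [hw, Equiv.swap_mul_self, one_mul]
  refine Nat.card_congr (Equiv.subtypeEquiv (Equiv.mulRight (Equiv.swap x y)) ?_)
  intro w
  simp only [Equiv.coe_mulRight]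
  constructor
  · rintro ⟨h1, h2⟩
    have h3 : w y = x := by
      rw [← h2, ← Equiv.Perm.mul_apply, h1]; rfl
    refine ⟨key w h1 ?_, ?_⟩
    · rw [Equiv.mul_swap_eq_swap_mul, h2, h3, Equiv.swap_comm]
    · intro a ha
      by_cases hx : a = x
      · subst hx; simp [h3]
      · have : a = y := by tauto
        subst this; simp [h2]
  · rintro ⟨h1, h2⟩
    have hx := h2 x (by simp)
    have hy := h2 y (by simp)
    have hw : w = (w * Equiv.swap x y) * Equiv.swap x y := by
      rw [mul_assoc, Equiv.swap_mul_self, mul_one]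
    constructor
    · rw [hw]
      refine key _ h1 ?_
      rw [Equiv.mul_swap_eq_swap_mul, hx, hy]
    · simpa using hy

theorem invCount_rec (n : ℕ) :
    invCount (Fin (n + 2)) = invCount (Fin (n + 1)) + (n + 1) * invCount (Fin n) := by
  have h1 : invCount (Fin (n + 2)) = ∑ y : Fin (n + 2),
      Nat.card {w : Equiv.Perm (Fin (n + 2)) // w * w = 1 ∧ w 0 = y} := by
    rw [← Nat.card_sigma]
    refine Nat.card_congr ?_
    refine (Equiv.sigmaFiberEquiv (fun w : {w : Equiv.Perm (Fin (n + 2)) // w * w = 1} =>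
      w.1 0)).symm.trans (Equiv.sigmaCongrRight fun y => ?_)
    exact Equiv.subtypeSubtypeEquivSubtypeInter _ (fun w : Equiv.Perm (Fin (n + 2)) => w 0 = y)
  rw [h1, Fin.sum_univ_succ]
  congr 1
  · rw [invCount_move]
    refine invCount_congr (Fintype.equivFinOfCardEq ?_)
    simp [Fintype.card_subtype_compl]
  · rw [Finset.sum_congr rfl (g := fun _ => invCount (Fin n))]
    · simp
    · intro y _
      rw [invCount_move]
      refine invCount_congr (Fintype.equivFinOfCardEq ?_)
      rw [Fintype.card_subtype]
      have : Finset.univ.filter (fun z : Fin (n + 2) => z ≠ 0 ∧ z ≠ y.succ)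
        = (Finset.univ.erase 0).erase y.succ := by ext; simp; tauto
      rw [this, Finset.card_erase_of_mem (by simp), Finset.card_erase_of_mem (by simp)]
      simp

theorem invCount_zero : invCount (Fin 0) = 1 := by
  unfold invCount
  rw [Nat.card_eq_one_iff_unique]
  exact ⟨⟨fun a b => Subtype.ext (Subsingleton.elim _ _)⟩, ⟨⟨1, by simp⟩⟩⟩

theorem invCount_one : invCount (Fin 1) = 1 := by
  unfold invCount
  rw [Nat.card_eq_one_iff_unique]
  exact ⟨⟨fun a b => Subtype.ext (Subsingleton.elim _ _)⟩, ⟨⟨1, by simp⟩⟩⟩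

theorem yd_card_le {μ : YoungDiagram} {i j : ℕ} (h : (i, j) ∈ μ) : i < μ.card ∧ j < μ.card := by
  constructor
  · have : μ.col j ⊆ μ.cells := Finset.filter_subset _ _
    have h2 := Finset.card_le_card this
    rw [← μ.colLen_eq_card] at h2
    exact lt_of_lt_of_le (YoungDiagram.mem_iff_lt_colLen.1 h) h2
  · have : μ.row i ⊆ μ.cells := Finset.filter_subset _ _
    have h2 := Finset.card_le_card this
    rw [← μ.rowLen_eq_card] at h2
    exact lt_of_lt_of_le (YoungDiagram.mem_iff_lt_rowLen.1 h) h2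

theorem yd_finite (n : ℕ) : {μ : YoungDiagram | μ.card = n}.Finite := by
  refine Set.Finite.of_finite_image (f := YoungDiagram.cells) ?_ ?_
  · refine Set.Finite.subset
      (Finset.finite_toSet (Finset.range n ×ˢ Finset.range n).powerset) ?_
    rintro _ ⟨μ, hμ, rfl⟩
    simp only [Finset.coe_powerset, Set.mem_preimage, Set.mem_powerset_iff, Finset.coe_subset]
    rintro ⟨i, j⟩ hc
    have := yd_card_le ((YoungDiagram.mem_cells _).1 hc)
    have hμ : μ.card = n := hμ
    simp; omega
  · intro a _ b _ h
    exact YoungDiagram.ext h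

/-- Young diagrams with `n` cells. -/
noncomputable def lev (n : ℕ) : Finset YoungDiagram := (yd_finite n).toFinset

@[simp] theorem mem_lev {n : ℕ} {μ : YoungDiagram} : μ ∈ lev n ↔ μ.card = n := by
  simp [lev]

open Classical in
/-- Diagrams covering `μ`. -/
noncomputable def ups (μ : YoungDiagram) : Finset YoungDiagram :=
  (lev (μ.card + 1)).filter (fun l => μ ≤ l)

open Classical in
/-- Diagrams covered by `μ`. -/
noncomputable def downs (μ : YoungDiagram) : Finset YoungDiagram :=
  (lev (μ.card - 1)).filter (fun l => l ≤ μ ∧ l.card + 1 = μ.card)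

@[simp] theorem mem_ups {μ l : YoungDiagram} : l ∈ ups μ ↔ μ ≤ l ∧ l.card = μ.card + 1 := by
  simp [ups]; tauto

@[simp] theorem mem_downs {μ l : YoungDiagram} : l ∈ downs μ ↔ l ≤ μ ∧ l.card + 1 = μ.card := by
  simp [downs]; omega

theorem yd_card_le_of_le {μ ν : YoungDiagram} (h : μ ≤ ν) : μ.card ≤ ν.card :=
  Finset.card_le_card (YoungDiagram.cells_subset_iff.2 h)

theorem yd_eq_of_le {μ ν : YoungDiagram} (h : μ ≤ ν) (hc : ν.card ≤ μ.card) : μ = ν :=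
  YoungDiagram.ext (Finset.eq_of_subset_of_card_le (YoungDiagram.cells_subset_iff.2 h) hc)

theorem yd_card_sup_add_inf (μ ν : YoungDiagram) :
    (μ ⊔ ν).card + (μ ⊓ ν).card = μ.card + ν.card := by
  unfold YoungDiagram.card
  rw [YoungDiagram.cells_sup, YoungDiagram.cells_inf]
  exact Finset.card_union_add_card_inter _ _

/-- Rows from which a cell can be removed. -/
def remRows (μ : YoungDiagram) : Finset ℕ :=
  (Finset.range μ.card).filter (fun i => μ.rowLen (i + 1) < μ.rowLen i)

/-- Rows to which a cell can be added. -/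
def addRows (μ : YoungDiagram) : Finset ℕ :=
  insert 0 ((remRows μ).map ⟨Nat.succ, Nat.succ_injective⟩)

theorem mem_remRows {μ : YoungDiagram} {i : ℕ} :
    i ∈ remRows μ ↔ μ.rowLen (i + 1) < μ.rowLen i := by
  simp only [remRows, Finset.mem_filter, Finset.mem_range, and_iff_right_iff_imp]
  intro h
  have : (i, 0) ∈ μ := YoungDiagram.mem_iff_lt_rowLen.2 (by omega)
  exact (yd_card_le this).1

theorem mem_addRows {μ : YoungDiagram} {i : ℕ} :
    i ∈ addRows μ ↔ ∀ k, k + 1 = i → μ.rowLen i < μ.rowLen k := by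
  simp only [addRows, Finset.mem_insert, Finset.mem_map, mem_remRows, Function.Embedding.coeFn_mk]
  constructor
  · rintro (rfl | ⟨k, h, rfl⟩) m hm
    · omega
    · obtain rfl : m = k := by omega
      exact h
  · intro h
    rcases i with _ | i
    · simp
    · exact Or.inr ⟨i, h i rfl, rfl⟩

theorem card_addRows (μ : YoungDiagram) : (addRows μ).card = (remRows μ).card + 1 := by
  rw [addRows, Finset.card_insert_of_notMem, Finset.card_map]
  simp

theorem yd_lower {μ : YoungDiagram} {a b : ℕ × ℕ} (h : b ≤ a) (ha : a ∈ μ.cells) : b ∈ μ.cells :=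
  μ.isLowerSet h ha

/-- Add a cell in row `i`. -/
def addCell (μ : YoungDiagram) (i : ℕ) (h : i ∈ addRows μ) : YoungDiagram where
  cells := insert (i, μ.rowLen i) μ.cells
  isLowerSet := by
    rintro ⟨a1, a2⟩ ⟨b1, b2⟩ hab ha
    simp only [Finset.coe_insert, Set.mem_insert_iff, Finset.mem_coe, Prod.mk.injEq,
      YoungDiagram.mem_cells] at ha ⊢
    rcases ha with ⟨rfl, rfl⟩ | ha
    · have h1 : b1 ≤ a1 := hab.1
      have h2 : b2 ≤ μ.rowLen a1 := hab.2
      by_cases hb : b1 = a1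
      · subst hb
        by_cases hb2 : b2 = μ.rowLen b1
        · exact Or.inl ⟨rfl, hb2⟩
        · exact Or.inr (YoungDiagram.mem_iff_lt_rowLen.2 (by omega))
      · right
        rw [mem_addRows] at h
        have h3 := h (a1 - 1) (by omega)
        have h4 := μ.rowLen_anti b1 (a1 - 1) (by omega)
        exact YoungDiagram.mem_iff_lt_rowLen.2 (by omega)
    · exact Or.inr (μ.up_left_mem hab.1 hab.2 ha)

theorem rowEnd_notMem (μ : YoungDiagram) (i : ℕ) : (i, μ.rowLen i) ∉ μ.cells := by
  rw [YoungDiagram.mem_cells, YoungDiagram.mem_iff_lt_rowLen]; omega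

/-- Remove a cell in row `i`. -/
def remCell (μ : YoungDiagram) (i : ℕ) (h : i ∈ remRows μ) : YoungDiagram where
  cells := μ.cells.erase (i, μ.rowLen i - 1)
  isLowerSet := by
    rintro ⟨a1, a2⟩ ⟨b1, b2⟩ hab ha
    simp only [Finset.coe_erase, Set.mem_sdiff, Set.mem_singleton_iff, Finset.mem_coe,
      YoungDiagram.mem_cells, Prod.mk.injEq] at ha ⊢
    refine ⟨μ.up_left_mem hab.1 hab.2 ha.1, ?_⟩
    rintro ⟨rfl, rfl⟩
    rw [mem_remRows] at h
    have h1 : b1 ≤ a1 := hab.1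
    have h2 : μ.rowLen b1 - 1 ≤ a2 := hab.2
    have h3 := YoungDiagram.mem_iff_lt_rowLen.1 ha.1
    have h5 := ha.2
    by_cases hb : b1 = a1
    · subst hb; omega
    · have h4 := μ.rowLen_anti (b1 + 1) a1 (by omega)
      omega

theorem exists_cell {μ l : YoungDiagram} (h1 : μ ≤ l) (h2 : l.card = μ.card + 1) :
    ∃ i, ∃ _ : i ∈ addRows μ, i ∈ remRows l ∧ l.rowLen i = μ.rowLen i + 1 ∧
      l.cells = insert (i, μ.rowLen i) μ.cells := by
  have hs := YoungDiagram.cells_subset_iff.2 h1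
  have hc : (l.cells \ μ.cells).card = 1 := by
    rw [Finset.card_sdiff_of_subset hs]
    change l.card - μ.card = 1
    omega
  obtain ⟨⟨i, j⟩, hij⟩ := Finset.card_eq_one.1 hc
  have hmem : ∀ a b, (a, b) ∈ l → (a, b) ∉ μ → a = i ∧ b = j := by
    intro a b ha hb
    have : (a, b) ∈ l.cells \ μ.cells := by simp [ha, hb]
    rw [hij] at this
    simpa using this
  have hl : (i, j) ∈ l ∧ (i, j) ∉ μ := by
    have : (i, j) ∈ l.cells \ μ.cells := by simp [hij]
    simpa using this
  obtain ⟨hl, hm⟩ := hl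
  have hj : j = μ.rowLen i := by
    by_contra hne
    have h3 : ¬ j < μ.rowLen i := fun h => hm (YoungDiagram.mem_iff_lt_rowLen.2 h)
    have := hmem i (μ.rowLen i) (l.up_left_mem le_rfl (by omega) hl)
      (by rw [YoungDiagram.mem_iff_lt_rowLen]; omega)
    omega
  subst hj
  have hlr : l.rowLen i = μ.rowLen i + 1 := by
    have := YoungDiagram.mem_iff_lt_rowLen.1 hl
    by_contra hne
    have := hmem i (μ.rowLen i + 1) (YoungDiagram.mem_iff_lt_rowLen.2 (by omega))
      (by rw [YoungDiagram.mem_iff_lt_rowLen]; omega)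
    omega
  have hadd : i ∈ addRows μ := by
    rw [mem_addRows]
    intro k hk
    by_contra hne
    have := hmem k (μ.rowLen i) (l.up_left_mem (by omega) le_rfl hl)
      (by rw [YoungDiagram.mem_iff_lt_rowLen]; omega)
    omega
  refine ⟨i, hadd, ?_, hlr, ?_⟩
  · rw [mem_remRows, hlr]
    by_contra hne
    have := hmem (i + 1) (μ.rowLen i) (YoungDiagram.mem_iff_lt_rowLen.2 (by omega))
      (by
        rw [YoungDiagram.mem_iff_lt_rowLen]
        have := μ.rowLen_anti i (i + 1) (by omega)
        omega)
    omega
  · rw [← Finset.sdiff_union_of_subset hs, hij]; rfl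

theorem card_ups (μ : YoungDiagram) : (ups μ).card = (addRows μ).card := by
  symm
  refine Finset.card_bij (fun i h => addCell μ i h) ?_ ?_ ?_
  · intro i h
    rw [mem_ups, ← YoungDiagram.cells_subset_iff]
    exact ⟨Finset.subset_insert _ _, Finset.card_insert_of_notMem (rowEnd_notMem μ i)⟩
  · intro i hi k hk h
    have h2 : (i, μ.rowLen i) ∈ (addCell μ k hk).cells := by
      rw [← h]; exact Finset.mem_insert_self _ _
    rcases Finset.mem_insert.1 h2 with h3 | h3
    · exact (Prod.mk.inj h3).1
    · exact absurd h3 (rowEnd_notMem μ i)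
  · intro l hl
    rw [mem_ups] at hl
    obtain ⟨i, hi, -, -, h⟩ := exists_cell hl.1 hl.2
    exact ⟨i, hi, YoungDiagram.ext h.symm⟩

theorem rowLast_mem {μ : YoungDiagram} {i : ℕ} (h : i ∈ remRows μ) :
    (i, μ.rowLen i - 1) ∈ μ.cells := by
  rw [mem_remRows] at h
  rw [YoungDiagram.mem_cells, YoungDiagram.mem_iff_lt_rowLen]; omega

theorem card_downs (μ : YoungDiagram) : (downs μ).card = (remRows μ).card := by
  symm
  refine Finset.card_bij (fun i h => remCell μ i h) ?_ ?_ ?_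
  · intro i h
    rw [mem_downs, ← YoungDiagram.cells_subset_iff]
    exact ⟨Finset.erase_subset _ _, Finset.card_erase_add_one (rowLast_mem h)⟩
  · intro i hi k hk h
    have h2 : (i, μ.rowLen i - 1) ∉ (remCell μ k hk).cells := by
      rw [← h]; exact Finset.notMem_erase _ _
    by_contra hne
    apply h2
    refine Finset.mem_erase.2 ⟨?_, rowLast_mem hi⟩
    intro h3
    exact hne (Prod.mk.inj h3).1
  · intro l hl
    rw [mem_downs] at hl
    obtain ⟨i, _, hi, hr, h⟩ := exists_cell hl.1 hl.2.symm
    refine ⟨i, hi, YoungDiagram.ext ?_⟩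
    change μ.cells.erase (i, μ.rowLen i - 1) = l.cells
    rw [hr, h, Nat.add_sub_cancel, Finset.erase_insert (rowEnd_notMem l i)]

theorem card_ups_eq (μ : YoungDiagram) : (ups μ).card = (downs μ).card + 1 := by
  rw [card_ups, card_downs, card_addRows]

open Classical in
theorem card_common {μ κ : YoungDiagram} (hc : κ.card = μ.card) (hne : κ ≠ μ) :
    (ups μ ∩ ups κ).card = (downs μ ∩ downs κ).card := by
  have hsi := yd_card_sup_add_inf μ κ
  have hlt : μ.card < (μ ⊔ κ).card := by
    by_contra h
    have h1 := yd_eq_of_le (le_sup_left : μ ≤ μ ⊔ κ) (by omega)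
    have h2 := yd_eq_of_le (le_sup_right : κ ≤ μ ⊔ κ) (by omega)
    exact hne (h2.trans h1.symm)
  by_cases h : (μ ⊔ κ).card = μ.card + 1
  · have e1 : ups μ ∩ ups κ = {μ ⊔ κ} := by
      ext l
      simp only [Finset.mem_inter, mem_ups, Finset.mem_singleton]
      constructor
      · rintro ⟨⟨a, b⟩, c, d⟩
        exact (yd_eq_of_le (sup_le a c) (by omega)).symm
      · rintro rfl
        exact ⟨⟨le_sup_left, h⟩, le_sup_right, by omega⟩
    have e2 : downs μ ∩ downs κ = {μ ⊓ κ} := by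
      ext l
      simp only [Finset.mem_inter, mem_downs, Finset.mem_singleton]
      constructor
      · rintro ⟨⟨a, b⟩, c, d⟩
        exact yd_eq_of_le (le_inf a c) (by omega)
      · rintro rfl
        exact ⟨⟨inf_le_left, by omega⟩, inf_le_right, by omega⟩
    rw [e1, e2]; simp
  · have e1 : ups μ ∩ ups κ = ∅ := by
      ext l
      simp only [Finset.mem_inter, mem_ups, Finset.notMem_empty, iff_false]
      rintro ⟨⟨a, b⟩, c, d⟩
      have := yd_card_le_of_le (sup_le a c)
      omega
    have e2 : downs μ ∩ downs κ = ∅ := by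
      ext l
      simp only [Finset.mem_inter, mem_downs, Finset.notMem_empty, iff_false]
      rintro ⟨⟨a, b⟩, c, d⟩
      have := yd_card_le_of_le (le_inf a c)
      omega
    rw [e1, e2]

open Classical in
theorem sum_up_down (f : YoungDiagram → ℕ) (μ : YoungDiagram) :
    ∑ l ∈ ups μ, ∑ κ ∈ downs l, f κ = f μ + ∑ ν ∈ downs μ, ∑ κ ∈ ups ν, f κ := by
  have h1 : ∑ l ∈ ups μ, ∑ κ ∈ downs l, f κ =
      ∑ κ ∈ lev μ.card, ∑ l ∈ ups μ ∩ ups κ, f κ := by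
    refine Finset.sum_comm' ?_
    intro l κ
    simp only [mem_ups, mem_downs, Finset.mem_inter, mem_lev]
    constructor
    · rintro ⟨⟨a, b⟩, c, d⟩; exact ⟨⟨⟨a, b⟩, c, by omega⟩, by omega⟩
    · rintro ⟨⟨⟨a, b⟩, c, d⟩, e⟩; exact ⟨⟨a, b⟩, c, by omega⟩
  have h2 : ∑ ν ∈ downs μ, ∑ κ ∈ ups ν, f κ =
      ∑ κ ∈ lev μ.card, ∑ l ∈ downs μ ∩ downs κ, f κ := by
    refine Finset.sum_comm' ?_
    intro l κ
    simp only [mem_ups, mem_downs, Finset.mem_inter, mem_lev]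
    constructor
    · rintro ⟨⟨a, b⟩, c, d⟩; exact ⟨⟨⟨a, b⟩, c, by omega⟩, by omega⟩
    · rintro ⟨⟨⟨a, b⟩, c, d⟩, e⟩; exact ⟨⟨a, b⟩, c, by omega⟩
  rw [h1, h2]
  have hm : μ ∈ lev μ.card := by simp
  rw [← Finset.add_sum_erase _ _ hm, ← Finset.add_sum_erase (lev μ.card) (fun κ => ∑ l ∈ downs μ ∩ downs κ, f κ) hm, ← add_assoc]
  congr 1
  · simp only [Finset.inter_self, Finset.sum_const, smul_eq_mul, card_ups_eq]; ring
  · refine Finset.sum_congr rfl ?_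
    intro κ hκ
    rw [Finset.mem_erase, mem_lev] at hκ
    simp only [Finset.sum_const, card_common hκ.2 hκ.1]

/-- Abstract recurrence. -/
theorem sum_ups_of_rec (f : YoungDiagram → ℕ)
    (hf : ∀ μ, 0 < μ.card → f μ = ∑ κ ∈ downs μ, f κ) (n : ℕ) :
    ∀ μ : YoungDiagram, μ.card = n → ∑ l ∈ ups μ, f l = (n + 1) * f μ := by
  induction n with
  | zero =>
    intro μ hμ
    have hd : downs μ = ∅ := by
      ext l; simp; omega
    rw [Finset.sum_congr rfl (g := fun l => ∑ κ ∈ downs l, f κ), sum_up_down, hd]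
    · simp
    · intro l hl
      rw [mem_ups] at hl
      exact hf l (by omega)
  | succ n ih =>
    intro μ hμ
    rw [Finset.sum_congr rfl (g := fun l => ∑ κ ∈ downs l, f κ), sum_up_down]
    · rw [Finset.sum_congr rfl (g := fun ν => (n + 1) * f ν), ← Finset.mul_sum,
        ← hf μ (by omega)]
      · ring
      · intro ν hν
        rw [mem_downs] at hν
        exact ih ν (by omega)
    · intro l hl
      rw [mem_ups] at hl
      exact hf l (by omega)

theorem lev_succ (f : YoungDiagram → ℕ)
    (hf : ∀ μ, 0 < μ.card → f μ = ∑ κ ∈ downs μ, f κ) (m : ℕ) :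
    ∑ μ ∈ lev (m + 1), f μ = ∑ κ ∈ lev m, ∑ l ∈ ups κ, f κ := by
  rw [Finset.sum_congr rfl (g := fun l => ∑ κ ∈ downs l, f κ)]
  · refine Finset.sum_comm' ?_
    intro l κ
    simp only [mem_ups, mem_downs, mem_lev]
    constructor
    · rintro ⟨a, b, c⟩; exact ⟨⟨b, by omega⟩, by omega⟩
    · rintro ⟨⟨a, b⟩, c⟩; exact ⟨by omega, a, by omega⟩
  · intro l hl
    rw [mem_lev] at hl
    exact hf l (by omega)

theorem lev_rec (f : YoungDiagram → ℕ)
    (hf : ∀ μ, 0 < μ.card → f μ = ∑ κ ∈ downs μ, f κ) (n : ℕ) :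
    ∑ μ ∈ lev (n + 2), f μ = ∑ μ ∈ lev (n + 1), f μ + (n + 1) * ∑ μ ∈ lev n, f μ := by
  have key2 : ∑ μ ∈ lev (n + 1), ∑ κ ∈ downs μ, f μ = ∑ ν ∈ lev n, ∑ μ ∈ ups ν, f μ := by
    refine Finset.sum_comm' ?_
    intro l κ
    simp only [mem_ups, mem_downs, mem_lev]
    constructor
    · rintro ⟨a, b, c⟩; exact ⟨⟨b, by omega⟩, by omega⟩
    · rintro ⟨⟨a, b⟩, c⟩; exact ⟨by omega, a, by omega⟩
  rw [lev_succ f hf (n + 1), Finset.mul_sum]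
  rw [Finset.sum_congr rfl (g := fun μ => f μ + ∑ κ ∈ downs μ, f μ), Finset.sum_add_distrib, key2]
  · congr 1
    refine Finset.sum_congr rfl ?_
    intro ν hν
    exact sum_ups_of_rec f hf n ν (mem_lev.1 hν)
  · intro μ _
    simp only [Finset.sum_const, card_ups_eq, smul_eq_mul]; ring

namespace StandardYoungTableau

theorem ext_of {n : ℕ} {S T : StandardYoungTableau n} (h1 : S.shape = T.shape)
    (h2 : ∀ i j, S.entry i j = T.entry i j) : S = T := by
  have h3 : S.entry = T.entry := by funext i j; exact h2 i j
  cases S; cases T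
  simp only at h1 h3
  subst h1 h3
  rfl

theorem entry_pos {n : ℕ} (T : StandardYoungTableau n) {i j : ℕ} (h : (i, j) ∈ T.shape) :
    1 ≤ T.entry i j ∧ T.entry i j ≤ n := Finset.mem_Icc.1 (T.entry_mem i j h)

theorem entry_le {n : ℕ} (T : StandardYoungTableau n) (i j : ℕ) : T.entry i j ≤ n := by
  by_cases h : (i, j) ∈ T.shape
  · exact (T.entry_pos h).2
  · rw [T.entry_eq_zero i j h]; omega

theorem entry_mono {n : ℕ} (T : StandardYoungTableau n) {i1 i2 j1 j2 : ℕ}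
    (hi : i1 ≤ i2) (hj : j1 ≤ j2) (h : (i2, j2) ∈ T.shape) :
    T.entry i1 j1 ≤ T.entry i2 j2 := by
  have h1 : T.entry i1 j1 ≤ T.entry i1 j2 := by
    rcases hj.eq_or_lt with rfl | hj
    · rfl
    · exact (T.row_strict i1 j1 j2 hj (T.shape.up_left_mem hi le_rfl h)).le
  have h2 : T.entry i1 j2 ≤ T.entry i2 j2 := by
    rcases hi.eq_or_lt with rfl | hi
    · rfl
    · exact (T.col_strict i1 i2 j2 hi h).le
  exact h1.trans h2

theorem card_filter {n : ℕ} (T : StandardYoungTableau (n + 1)) :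
    (T.shape.cells.filter (fun c => T.entry c.1 c.2 ≤ n)).card = n := by
  have hinj : Set.InjOn (fun c : ℕ × ℕ => T.entry c.1 c.2) (T.shape.cells : Set (ℕ × ℕ)) := by
    intro a ha b hb h
    exact T.entry_injOn (by simpa using ha) (by simpa using hb) h
  have himg : T.shape.cells.image (fun c : ℕ × ℕ => T.entry c.1 c.2) = Finset.Icc 1 (n + 1) := by
    apply Finset.eq_of_subset_of_card_le
    · intro x hx
      obtain ⟨c, hc, rfl⟩ := Finset.mem_image.1 hx
      exact T.entry_mem c.1 c.2 ((YoungDiagram.mem_cells _).1 hc)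
    · rw [Finset.card_image_of_injOn hinj]
      have : T.shape.cells.card = n + 1 := T.card_eq
      simp [this]
  have h2 : (T.shape.cells.filter (fun c => T.entry c.1 c.2 ≤ n)).image
      (fun c : ℕ × ℕ => T.entry c.1 c.2) = Finset.Icc 1 n := by
    ext x
    have hx : x ∈ T.shape.cells.image (fun c : ℕ × ℕ => T.entry c.1 c.2) ↔
      x ∈ Finset.Icc 1 (n + 1) := by rw [himg]
    simp only [Finset.mem_image, Finset.mem_filter, Finset.mem_Icc] at hx ⊢
    constructor
    · rintro ⟨c, ⟨h1, h2⟩, rfl⟩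
      exact ⟨(hx.1 ⟨c, h1, rfl⟩).1, h2⟩
    · rintro ⟨h1, h2⟩
      obtain ⟨c, hc, rfl⟩ := hx.2 ⟨h1, by omega⟩
      exact ⟨c, ⟨hc, h2⟩, rfl⟩
  have h3 := congrArg Finset.card h2
  rw [Finset.card_image_of_injOn (hinj.mono (by intro x hx; exact (Finset.mem_filter.1 hx).1))] at h3
  simpa using h3

/-- The cells other than the one with the largest entry. -/
def restrictShape {n : ℕ} (T : StandardYoungTableau (n + 1)) : YoungDiagram where
  cells := T.shape.cells.filter (fun c => T.entry c.1 c.2 ≤ n)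
  isLowerSet := by
    rintro ⟨a1, a2⟩ ⟨b1, b2⟩ hab ha
    simp only [Finset.mem_coe, Finset.mem_filter, YoungDiagram.mem_cells] at ha ⊢
    exact ⟨T.shape.up_left_mem hab.1 hab.2 ha.1,
      (T.entry_mono hab.1 hab.2 ha.1).trans ha.2⟩

theorem mem_restrictShape {n : ℕ} (T : StandardYoungTableau (n + 1)) (i j : ℕ) :
    (i, j) ∈ T.restrictShape ↔ (i, j) ∈ T.shape ∧ T.entry i j ≤ n := by
  rw [← YoungDiagram.mem_cells, restrictShape, Finset.mem_filter, YoungDiagram.mem_cells]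

/-- Remove the cell with the largest entry. -/
def restrict {n : ℕ} (T : StandardYoungTableau (n + 1)) : StandardYoungTableau n where
  shape := T.restrictShape
  card_eq := T.card_filter
  entry i j := if T.entry i j ≤ n then T.entry i j else 0
  row_strict := by
    intro i j1 j2 hj h
    rw [mem_restrictShape] at h
    have := T.row_strict i j1 j2 hj h.1
    rw [if_pos h.2, if_pos (by omega)]
    exact this
  col_strict := by
    intro i1 i2 j hi h
    rw [mem_restrictShape] at h
    have := T.col_strict i1 i2 j hi h.1
    rw [if_pos h.2, if_pos (by omega)]
    exact this
  entry_mem := by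
    intro i j h
    rw [mem_restrictShape] at h
    rw [if_pos h.2, Finset.mem_Icc]
    exact ⟨(T.entry_pos h.1).1, h.2⟩
  entry_injOn := by
    rintro ⟨a1, a2⟩ ha ⟨b1, b2⟩ hb h
    replace ha := (T.mem_restrictShape a1 a2).1 ha
    replace hb := (T.mem_restrictShape b1 b2).1 hb
    simp only [if_pos ha.2, if_pos hb.2] at h
    exact T.entry_injOn ha.1 hb.1 h
  entry_eq_zero := by
    intro i j h
    rw [mem_restrictShape, not_and] at h
    by_cases hm : (i, j) ∈ T.shape
    · rw [if_neg (h hm)]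
    · rw [T.entry_eq_zero i j hm]; simp

theorem mem_restrict {n : ℕ} (T : StandardYoungTableau (n + 1)) (i j : ℕ) :
    (i, j) ∈ T.restrict.shape ↔ (i, j) ∈ T.shape ∧ T.entry i j ≤ n :=
  T.mem_restrictShape i j

theorem restrict_mem_downs {n : ℕ} (T : StandardYoungTableau (n + 1)) :
    T.restrict.shape ∈ downs T.shape := by
  rw [mem_downs, T.restrict.card_eq, T.card_eq, ← YoungDiagram.cells_subset_iff]
  exact ⟨Finset.filter_subset _ _, rfl⟩

theorem new_unique {μ l : YoungDiagram} (h : μ ∈ downs l) {c d : ℕ × ℕ}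
    (hc : c ∈ l) (hc' : c ∉ μ) (hd : d ∈ l) (hd' : d ∉ μ) : c = d := by
  rw [mem_downs] at h
  obtain ⟨i, -, -, -, he⟩ := exists_cell h.1 h.2.symm
  have key : ∀ c, c ∈ l → c ∉ μ → c = (i, μ.rowLen i) := by
    intro c hc hc'
    rw [← YoungDiagram.mem_cells, he, Finset.mem_insert] at hc
    rcases hc with hc | hc
    · exact hc
    · exact absurd hc hc'
  rw [key c hc hc', key d hd hd']

open Classical in
/-- Put the new largest entry in the new cell. -/
noncomputable def extend {n : ℕ} (T : StandardYoungTableau n) (l : YoungDiagram)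
    (h : T.shape ∈ downs l) : StandardYoungTableau (n + 1) where
  shape := l
  card_eq := by
    have := (mem_downs.1 h).2
    rw [← this, T.card_eq]
  entry i j := if (i, j) ∈ T.shape then T.entry i j else if (i, j) ∈ l then n + 1 else 0
  row_strict := by
    intro i j1 j2 hj hl
    have hl1 : (i, j1) ∈ l := l.up_left_mem le_rfl hj.le hl
    by_cases h2 : (i, j2) ∈ T.shape
    · have h1 : (i, j1) ∈ T.shape := T.shape.up_left_mem le_rfl hj.le h2
      rw [if_pos h1, if_pos h2]
      exact T.row_strict i j1 j2 hj h2
    · have h1 : (i, j1) ∈ T.shape := by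
        by_contra h1
        have := new_unique h hl1 h1 hl h2
        simp only [Prod.mk.injEq] at this
        omega
      rw [if_pos h1, if_neg h2, if_pos hl]
      have := T.entry_le i j1
      omega
  col_strict := by
    intro i1 i2 j hi hl
    have hl1 : (i1, j) ∈ l := l.up_left_mem hi.le le_rfl hl
    by_cases h2 : (i2, j) ∈ T.shape
    · have h1 : (i1, j) ∈ T.shape := T.shape.up_left_mem hi.le le_rfl h2
      rw [if_pos h1, if_pos h2]
      exact T.col_strict i1 i2 j hi h2
    · have h1 : (i1, j) ∈ T.shape := by
        by_contra h1
        have := new_unique h hl1 h1 hl h2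
        simp only [Prod.mk.injEq] at this
        omega
      rw [if_pos h1, if_neg h2, if_pos hl]
      have := T.entry_le i1 j
      omega
  entry_mem := by
    intro i j hl
    rw [Finset.mem_Icc]
    by_cases h2 : (i, j) ∈ T.shape
    · rw [if_pos h2]
      have := T.entry_pos h2
      omega
    · rw [if_neg h2, if_pos hl]; omega
  entry_injOn := by
    rintro ⟨a1, a2⟩ ha ⟨b1, b2⟩ hb hab
    simp only [Set.mem_ofPred_eq] at ha hb
    simp only at hab
    have hA := T.entry_le a1 a2
    have hB := T.entry_le b1 b2
    by_cases h1 : (a1, a2) ∈ T.shape <;> by_cases h2 : (b1, b2) ∈ T.shape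
    · rw [if_pos h1, if_pos h2] at hab
      exact T.entry_injOn h1 h2 hab
    · rw [if_pos h1, if_neg h2, if_pos hb] at hab
      omega
    · rw [if_neg h1, if_pos h2, if_pos ha] at hab
      omega
    · exact new_unique h ha h1 hb h2
  entry_eq_zero := by
    intro i j hl
    have h1 : (i, j) ∉ T.shape := fun h1 => hl ((mem_downs.1 h).1 h1)
    rw [if_neg h1, if_neg hl]

theorem restrict_extend {n : ℕ} (T : StandardYoungTableau n) (l : YoungDiagram)
    (h : T.shape ∈ downs l) : (T.extend l h).restrict = T := by
  have hle := (mem_downs.1 h).1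
  refine ext_of ?_ ?_
  · refine YoungDiagram.ext ?_
    ext ⟨i, j⟩
    rw [YoungDiagram.mem_cells, YoungDiagram.mem_cells, mem_restrict]
    simp only [extend]
    have := T.entry_le i j
    by_cases h1 : (i, j) ∈ T.shape
    · have h2 : (i, j) ∈ l := hle h1
      simp [h1, h2, this]
    · by_cases h2 : (i, j) ∈ l <;> simp [h1, h2]
  · intro i j
    simp only [restrict, extend]
    have := T.entry_le i j
    by_cases h1 : (i, j) ∈ T.shape
    · simp [h1, this]
    · have h0 := T.entry_eq_zero i j h1
      by_cases h2 : (i, j) ∈ l <;> simp [h0, h1, h2]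

theorem extend_restrict {n : ℕ} (T : StandardYoungTableau (n + 1)) (l : YoungDiagram)
    (hl : T.shape = l) (h : T.restrict.shape ∈ downs l) : T.restrict.extend l h = T := by
  subst hl
  refine ext_of rfl ?_
  intro i j
  simp only [extend, mem_restrict]
  by_cases h2 : (i, j) ∈ T.shape
  · have := T.entry_pos h2
    by_cases h1 : T.entry i j ≤ n
    · simp [h1, h2, restrict]
    · simp [h1, h2]; omega
  · simp [h2, T.entry_eq_zero i j h2]

/-- The recursive structure of tableaux of a given shape. -/
noncomputable def equivRestrict (n : ℕ) (l : YoungDiagram) :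
    {T : StandardYoungTableau (n + 1) // T.shape = l} ≃
      {T : StandardYoungTableau n // T.shape ∈ downs l} where
  toFun T := ⟨T.1.restrict, by
    have := T.1.restrict_mem_downs
    rwa [T.2] at this⟩
  invFun T := ⟨T.1.extend l T.2, rfl⟩
  left_inv T := Subtype.ext (extend_restrict T.1 l T.2 (by
    have := T.1.restrict_mem_downs
    rwa [T.2] at this))
  right_inv T := Subtype.ext (restrict_extend T.1 l T.2)

theorem unique_zero : Nat.card (StandardYoungTableau 0) = 1 := by
  have hmem : ∀ (T : StandardYoungTableau 0) i j, (i, j) ∉ T.shape := by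
    intro T i j h
    have := T.entry_pos h
    omega
  rw [Nat.card_eq_one_iff_unique]
  refine ⟨⟨fun S T => ext_of ?_ ?_⟩, ⟨?_⟩⟩
  · refine YoungDiagram.ext ?_
    ext ⟨i, j⟩
    simp [hmem]
  · intro i j
    rw [S.entry_eq_zero i j (hmem S i j), T.entry_eq_zero i j (hmem T i j)]
  · exact
      { shape := ⊥
        card_eq := by simp
        entry := fun _ _ => 0
        row_strict := fun i j1 j2 _ h => absurd h (YoungDiagram.notMem_bot _)
        col_strict := fun i j1 j2 _ h => absurd h (YoungDiagram.notMem_bot _)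
        entry_mem := fun i j h => absurd h (YoungDiagram.notMem_bot _)
        entry_injOn := fun a h => absurd h (YoungDiagram.notMem_bot _)
        entry_eq_zero := fun _ _ _ => rfl }

theorem finite_all (n : ℕ) : Finite (StandardYoungTableau n) := by
  induction n with
  | zero => exact Nat.finite_of_card_ne_zero (by rw [unique_zero]; simp)
  | succ n ih =>
    have : Finite {μ : YoungDiagram // μ.card = n + 1} := (yd_finite (n + 1)).to_subtype
    refine Finite.of_injective
      (fun T : StandardYoungTableau (n + 1) =>
        ((⟨T.shape, T.card_eq⟩ : {μ : YoungDiagram // μ.card = n + 1}), T.restrict)) ?_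
    intro S T h
    simp only [Prod.mk.injEq, Subtype.mk.injEq] at h
    have h1 := extend_restrict S T.shape h.1 (by rw [h.2]; exact T.restrict_mem_downs)
    have h2 := extend_restrict T T.shape rfl T.restrict_mem_downs
    refine h1.symm.trans (Eq.trans ?_ h2)
    congr 1
    exact h.2

/-- The number of tableaux of shape `μ` among the tableaux with `n` boxes. -/
noncomputable def num (n : ℕ) (μ : YoungDiagram) : ℕ :=
  Nat.card {T : StandardYoungTableau n // T.shape = μ}

theorem card_mem (n : ℕ) (s : Finset YoungDiagram) :
    Nat.card {T : StandardYoungTableau n // T.shape ∈ s} = ∑ μ ∈ s, num n μ := by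
  have := finite_all n
  rw [← Finset.sum_coe_sort s]
  unfold num
  rw [← Nat.card_sigma]
  refine Nat.card_congr ?_
  refine (Equiv.sigmaFiberEquiv (fun T : {T : StandardYoungTableau n // T.shape ∈ s} =>
      (⟨T.1.shape, T.2⟩ : s))).symm.trans (Equiv.sigmaCongrRight fun μ => ?_)
  refine (Equiv.subtypeEquivRight (q := fun T => T.1.shape = μ.1) ?_).trans ?_
  · intro T; exact Subtype.ext_iff
  · refine Equiv.subtypeSubtypeEquivSubtype
      (p := fun T : StandardYoungTableau n => T.shape ∈ s) (q := fun T => T.shape = μ.1) ?_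
    intro T h
    rw [h]; exact μ.2

theorem card_eq_sum (n : ℕ) :
    Nat.card (StandardYoungTableau n) = ∑ μ ∈ lev n, num μ.card μ := by
  rw [Finset.sum_congr rfl (g := fun μ => num n μ), ← card_mem]
  · exact Nat.card_congr (Equiv.subtypeUnivEquiv (fun T => mem_lev.2 T.card_eq)).symm
  · intro μ h
    rw [mem_lev] at h
    rw [h]

theorem num_rec (μ : YoungDiagram) (h : 0 < μ.card) :
    num μ.card μ = ∑ κ ∈ downs μ, num κ.card κ := by
  obtain ⟨n, hn⟩ : ∃ n, μ.card = n + 1 := ⟨μ.card - 1, by omega⟩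
  rw [hn, num, Nat.card_congr (equivRestrict n μ), card_mem]
  refine Finset.sum_congr rfl ?_
  intro κ hκ
  rw [mem_downs] at hκ
  have : κ.card = n := by omega
  rw [this]

theorem card_rec (n : ℕ) : Nat.card (StandardYoungTableau (n + 2)) =
    Nat.card (StandardYoungTableau (n + 1)) + (n + 1) * Nat.card (StandardYoungTableau n) := by
  simp only [card_eq_sum]
  exact lev_rec (fun μ => num μ.card μ) num_rec n

theorem card_one : Nat.card (StandardYoungTableau 1) = 1 := by
  have h0 : ∑ μ ∈ lev 0, num μ.card μ = 1 := by rw [← card_eq_sum, unique_zero]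
  rw [card_eq_sum, lev_succ _ num_rec 0]
  rw [← h0]
  refine Finset.sum_congr rfl ?_
  intro κ hκ
  rw [mem_lev] at hκ
  have hd : downs κ = ∅ := by ext l; simp; omega
  simp [card_ups_eq, hd]

end StandardYoungTableau

theorem card_involutions_eq_card_SYT (n : ℕ) :
    Nat.card {w : Equiv.Perm (Fin n) // w * w = 1} =
      Nat.card (StandardYoungTableau n) := by
  suffices h : ∀ n, invCount (Fin n) = Nat.card (StandardYoungTableau n) ∧
      invCount (Fin (n + 1)) = Nat.card (StandardYoungTableau (n + 1)) from (h n).1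
  intro n
  induction n with
  | zero =>
    exact ⟨by rw [invCount_zero, StandardYoungTableau.unique_zero],
      by rw [invCount_one, StandardYoungTableau.card_one]⟩
  | succ n ih =>
    refine ⟨ih.2, ?_⟩
    rw [invCount_rec, StandardYoungTableau.card_rec, ih.1, ih.2]
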